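/- For every n ≥ 1 and t > 0, the quantities R_n satisfy the non-linear second order difference equation 4(−1)^n t [(n+1) R_{n+1}(t) − n R_{n−1}(t)] + (2n+1) R_{n+1}(t) R_n(t) R_{n−1}(t) = [4(−1)^n t − R_{n+1}(t) R_n(t)] · [4(−1)^n t + R_n(t) R_{n−1}(t)]. -/

import Mathlib

open MeasureTheory Polynomial

/-- The singularly perturbed Gaussian weight `w(x,t) = exp(-x^2 - t/x^2)` for `x ≠ 0`,
extended by `0` at `x = 0`. -/
noncomputable def w (t x : ℝ) : ℝ := if x = 0 then 0 else Real.exp (-x ^ 2 - t / x ^ 2)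

theorem degree_lt_of_coeff_eq {p : ℝ[X]} {n : ℕ} (hp : p.natDegree ≤ n) (hc : p.coeff n = 0) :
    p.degree < n := by
  rw [degree_lt_iff_coeff_zero]
  intro k hk
  rcases hk.eq_or_lt with rfl | hk
  · exact hc
  · exact coeff_eq_zero_of_natDegree_lt (by omega)

theorem moment_eq_coeff_mul {Φ : ℝ[X] →ₗ[ℝ] ℝ} {P : ℕ → ℝ[X]}
    (hmonic : ∀ n, (P n).Monic) (hdeg : ∀ n, (P n).natDegree = n)
    (horth : ∀ m n, m ≠ n → Φ (X ^ 3 * (P m * P n)) = 0)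
    (n : ℕ) (q : ℝ[X]) (hq : q.natDegree ≤ n) :
    Φ (X ^ 3 * (P n * q)) = q.coeff n * Φ (X ^ 3 * (P n * P n)) := by
  have key : ∀ d : ℕ, ∀ q : ℝ[X], q.degree < d → d ≤ n → Φ (X ^ 3 * (P n * q)) = 0 := by
    intro d
    induction d with
    | zero =>
      intro q hq _
      have : q = 0 := by simpa using hq
      simp [this]
    | succ d ih =>
      intro q hq hd
      have hc : (P d).coeff d = 1 := by simpa [hdeg] using (hmonic d).coeff_natDegree
      have h1 : (q - C (q.coeff d) * P d).degree < d := by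
        rw [degree_lt_iff_coeff_zero]
        intro k hk
        rcases hk.eq_or_lt with rfl | hk
        · simp [hc]
        · have e1 : q.coeff k = 0 := by
            rw [degree_lt_iff_coeff_zero] at hq
            exact hq k hk
          have e2 : (P d).coeff k = 0 := coeff_eq_zero_of_natDegree_lt (by rw [hdeg]; exact hk)
          simp [e1, e2]
      have h2 := ih _ h1 (by omega)
      have h3 : X ^ 3 * (P n * q) = X ^ 3 * (P n * (q - C (q.coeff d) * P d))
          + q.coeff d • (X ^ 3 * (P n * P d)) := by
        rw [smul_eq_C_mul]; ring
      rw [h3, map_add, h2, map_smul, horth n d (by omega)]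
      simp
  have hc : (P n).coeff n = 1 := by simpa [hdeg] using (hmonic n).coeff_natDegree
  have h1 : (q - C (q.coeff n) * P n).degree < n := by
    apply degree_lt_of_coeff_eq
    · exact (natDegree_sub_le _ _).trans
        (max_le hq ((natDegree_C_mul_le _ _).trans (hdeg n).le))
    · simp [hc]
  have h3 : X ^ 3 * (P n * q) = X ^ 3 * (P n * (q - C (q.coeff n) * P n))
      + q.coeff n • (X ^ 3 * (P n * P n)) := by
    rw [smul_eq_C_mul]; ring
  rw [h3, map_add, key n _ h1 le_rfl, map_smul]
  simp

theorem eq_zero_of_moments_eq_zero {Φ : ℝ[X] →ₗ[ℝ] ℝ} {P : ℕ → ℝ[X]}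
    (hmonic : ∀ n, (P n).Monic) (hdeg : ∀ n, (P n).natDegree = n)
    (horth : ∀ m n, m ≠ n → Φ (X ^ 3 * (P m * P n)) = 0)
    (hpos : ∀ n, 0 < Φ (X ^ 3 * (P n * P n)))
    (n : ℕ) (D : ℝ[X]) (hD : D.degree < n)
    (hz : ∀ m < n, Φ (X ^ 3 * (P m * D)) = 0) : D = 0 := by
  by_contra hne
  have hlt : D.natDegree < n := (natDegree_lt_iff_degree_lt hne).2 hD
  have h1 := hz _ hlt
  rw [moment_eq_coeff_mul hmonic hdeg horth _ D le_rfl] at h1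
  have := hpos D.natDegree
  rcases mul_eq_zero.1 h1 with h | h
  · exact hne (leadingCoeff_eq_zero.1 h)
  · linarith

theorem coeff_comp_neg_X (p : ℝ[X]) (k : ℕ) : (p.comp (-X)).coeff k = (-1) ^ k * p.coeff k := by
  have : (-X : ℝ[X]) = C (-1) * X := by simp
  rw [this, comp_C_mul_X_coeff, mul_comm]

theorem orthogonal_comp_neg_X {Φ : ℝ[X] →ₗ[ℝ] ℝ} {P : ℕ → ℝ[X]}
    (hmonic : ∀ n, (P n).Monic) (hdeg : ∀ n, (P n).natDegree = n)
    (horth : ∀ m n, m ≠ n → Φ (X ^ 3 * (P m * P n)) = 0)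
    (hpos : ∀ n, 0 < Φ (X ^ 3 * (P n * P n)))
    (hneg : ∀ p : ℝ[X], Φ (p.comp (-X)) = -Φ p) (n : ℕ) :
    (P n).comp (-X) = C ((-1) ^ n) * P n := by
  have hdn : ∀ p : ℝ[X], (p.comp (-X)).natDegree = p.natDegree := by
    intro p; simp [natDegree_comp]
  have hc : (P n).coeff n = 1 := by simpa [hdeg] using (hmonic n).coeff_natDegree
  have hD : ((P n).comp (-X) - C ((-1) ^ n) * P n).degree < (n : WithBot ℕ) := by
    apply degree_lt_of_coeff_eq
    · refine (natDegree_sub_le _ _).trans (max_le ?_ ?_)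
      · rw [hdn, hdeg]
      · exact (natDegree_C_mul_le _ _).trans (hdeg n).le
    · rw [coeff_sub, coeff_comp_neg_X, coeff_C_mul, hc, sub_self]
  refine sub_eq_zero.1 (eq_zero_of_moments_eq_zero hmonic hdeg horth hpos n _ hD ?_)
  intro m hm
  have h1 : X ^ 3 * (P m * ((P n).comp (-X) - C ((-1) ^ n) * P n)) =
      -((X ^ 3 * (P n * (P m).comp (-X))).comp (-X)) - ((-1 : ℝ) ^ n) • (X ^ 3 * (P m * P n)) := by
    have : ((P m).comp (-X)).comp (-X) = P m := by rw [comp_assoc]; simp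
    rw [smul_eq_C_mul]
    simp only [mul_comp, pow_comp, X_comp, this]
    ring
  rw [h1, map_sub, map_neg, hneg, map_smul, horth m n hm.ne,
    moment_eq_coeff_mul hmonic hdeg horth n _ (by rw [hdn, hdeg]; exact hm.le),
    coeff_eq_zero_of_natDegree_lt (by rw [hdn, hdeg]; exact hm)]
  simp

theorem coeff_eq_zero_of_odd_add {p : ℝ[X]} {n : ℕ} (hp : p.comp (-X) = C ((-1) ^ n) * p)
    {k : ℕ} (hk : Odd (n + k)) : p.coeff k = 0 := by
  have h1 := congrArg (fun q => coeff q k) hp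
  simp only [coeff_comp_neg_X, coeff_C_mul] at h1
  rcases Nat.even_or_odd n with hn | hn
  · have : Odd k := by grind
    rw [hn.neg_one_pow, this.neg_one_pow] at h1
    linarith
  · have : Even k := by grind
    rw [hn.neg_one_pow, this.neg_one_pow] at h1
    linarith

theorem three_term_recurrence {Φ : ℝ[X] →ₗ[ℝ] ℝ} {P : ℕ → ℝ[X]}
    (hmonic : ∀ n, (P n).Monic) (hdeg : ∀ n, (P n).natDegree = n)
    (horth : ∀ m n, m ≠ n → Φ (X ^ 3 * (P m * P n)) = 0)
    (hpos : ∀ n, 0 < Φ (X ^ 3 * (P n * P n)))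
    (hneg : ∀ p : ℝ[X], Φ (p.comp (-X)) = -Φ p) (m : ℕ) :
    X * P (m + 1) = P (m + 2) +
      C (Φ (X ^ 3 * (P (m + 1) * P (m + 1))) / Φ (X ^ 3 * (P m * P m))) * P m := by
  set β := Φ (X ^ 3 * (P (m + 1) * P (m + 1))) / Φ (X ^ 3 * (P m * P m)) with hβ
  have hc : ∀ n, (P n).coeff n = 1 := fun n => by
    simpa [hdeg] using (hmonic n).coeff_natDegree
  have hXdeg : ∀ n, (X * P n).natDegree = n + 1 := fun n => by
    rw [natDegree_X_mul (hmonic n).ne_zero, hdeg]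
  have hD : (X * P (m + 1) - (P (m + 2) + C β * P m)).degree < ((m + 2 : ℕ) : WithBot ℕ) := by
    apply degree_lt_of_coeff_eq
    · refine (natDegree_sub_le _ _).trans (max_le (hXdeg _).le ?_)
      refine (natDegree_add_le _ _).trans (max_le (hdeg _).le ?_)
      exact (natDegree_C_mul_le _ _).trans (by rw [hdeg]; omega)
    · have : (P m).coeff (m + 2) = 0 := coeff_eq_zero_of_natDegree_lt (by rw [hdeg]; omega)
      simp [coeff_X_mul, hc, this]
  refine sub_eq_zero.1 (eq_zero_of_moments_eq_zero hmonic hdeg horth hpos _ _ hD ?_)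
  intro k hk
  have h1 : X ^ 3 * (P k * (X * P (m + 1) - (P (m + 2) + C β * P m))) =
      X ^ 3 * (P (m + 1) * (X * P k)) - X ^ 3 * (P k * P (m + 2))
        - β • (X ^ 3 * (P k * P m)) := by
    rw [smul_eq_C_mul]; ring
  rw [h1, map_sub, map_sub, map_smul, horth k (m + 2) (by omega)]
  rcases (show k = m + 1 ∨ k ≤ m by omega) with rfl | hkm
  · have h2 := hneg (X ^ 3 * (P (m + 1) * (X * P (m + 1))))
    have h3 : (X ^ 3 * (P (m + 1) * (X * P (m + 1)))).comp (-X) =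
        X ^ 3 * (P (m + 1) * (X * P (m + 1))) := by
      simp only [mul_comp, pow_comp, X_comp,
        orthogonal_comp_neg_X hmonic hdeg horth hpos hneg]
      have : (C ((-1 : ℝ) ^ (m + 1)) : ℝ[X]) * C ((-1 : ℝ) ^ (m + 1)) = 1 := by
        rw [← C_mul, ← pow_add, Even.neg_one_pow ⟨m + 1, rfl⟩, C_1]
      linear_combination (X ^ 4 * P (m + 1) ^ 2) * this
    rw [h3] at h2
    rw [horth (m + 1) m (by omega), smul_zero]
    linarith
  · rw [moment_eq_coeff_mul hmonic hdeg horth (m + 1) _ (by rw [hXdeg]; omega), coeff_X_mul]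
    rcases hkm.eq_or_lt with rfl | hkm
    · rw [hc, hβ, smul_eq_mul, div_mul_cancel₀ _ (hpos k).ne']
      ring
    · rw [horth k m hkm.ne, coeff_eq_zero_of_natDegree_lt (by rw [hdeg]; exact hkm)]
      simp

/-- The `z⁻⁴` coefficient of the quadratic compatibility condition for the ladder operators. -/
theorem ladder_compatibility {Φ : ℝ[X] →ₗ[ℝ] ℝ} {P : ℕ → ℝ[X]}
    (hmonic : ∀ n, (P n).Monic) (hdeg : ∀ n, (P n).natDegree = n)
    (horth : ∀ m n, m ≠ n → Φ (X ^ 3 * (P m * P n)) = 0)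
    (hpos : ∀ n, 0 < Φ (X ^ 3 * (P n * P n)))
    (hneg : ∀ p : ℝ[X], Φ (p.comp (-X)) = -Φ p) (m : ℕ) :
    Φ (X ^ 3 * (P m * P m)) * Φ (P (m + 1) * P m) =
      (-1) ^ m * Φ (X * (P (m + 1) * P (m + 1))) * Φ (X * (P m * P m)) := by
  have hL := moment_eq_coeff_mul hmonic hdeg horth
  have hcoeff : ∀ n k, Odd (n + k) → (P n).coeff k = 0 := fun n k =>
    coeff_eq_zero_of_odd_add (orthogonal_comp_neg_X hmonic hdeg horth hpos hneg n)
  have hc : ∀ n, (P n).coeff n = 1 := fun n => by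
    simpa [hdeg] using (hmonic n).coeff_natDegree
  have hlow : ∀ n (q : ℝ[X]), q.natDegree < n → Φ (X ^ 3 * (P n * q)) = 0 := fun n q hq => by
    rw [hL n q hq.le, coeff_eq_zero_of_natDegree_lt hq, zero_mul]
  have hone : ∀ n (p : ℝ[X]), Φ (X ^ 2 * (P n * p)) =
      p.coeff 0 * Φ (X ^ 2 * P n) + Φ (X ^ 3 * (P n * p.divX)) := fun n p => by
    have : X ^ 2 * (P n * p) = p.coeff 0 • (X ^ 2 * P n) + X ^ 3 * (P n * p.divX) := by
      nth_rw 1 [← divX_mul_X_add p]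
      rw [smul_eq_C_mul]; ring
    rw [this, map_add, map_smul, smul_eq_mul]
  have htwo : ∀ n (p : ℝ[X]), p.coeff 1 = 0 → p.natDegree ≤ n + 1 →
      Φ (X * (P n * p)) = p.coeff 0 * Φ (X * P n) := fun n p h1 hp => by
    have h2 : p = p.divX.divX * X ^ 2 + C (p.coeff 0) := by
      conv_lhs => rw [← divX_mul_X_add p, ← divX_mul_X_add p.divX]
      simp only [coeff_divX, zero_add, h1, C_0]
      ring
    have : X * (P n * p) = p.coeff 0 • (X * P n) + X ^ 3 * (P n * p.divX.divX) := by
      nth_rw 1 [h2]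
      rw [smul_eq_C_mul]; ring
    rw [this, map_add, map_smul, smul_eq_mul, hL n _ ?_, coeff_divX, coeff_divX,
      coeff_eq_zero_of_natDegree_lt (Nat.lt_succ_of_le hp), zero_mul, add_zero]
    rw [natDegree_divX_eq_natDegree_tsub_one, natDegree_divX_eq_natDegree_tsub_one]
    omega
  have hfac : ∀ n, Odd n → P n = X * (P n).divX := fun n hn => by
    conv_lhs => rw [← divX_mul_X_add (P n), hcoeff n 0 (by simpa using hn)]
    rw [C_0]; ring
  have hdd : ∀ n, (P n).divX.natDegree = n - 1 := fun n => by
    rw [natDegree_divX_eq_natDegree_tsub_one, hdeg]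
  have hmon := hL m (P (m + 1)).divX (by rw [hdd]; omega)
  rw [coeff_divX, hc, one_mul] at hmon
  have hPP : X ^ 2 * (P m * P (m + 1)) = X ^ 2 * (P (m + 1) * P m) := by ring
  have hmd : Φ (X ^ 3 * (P (m + 1) * (P m).divX)) = 0 := hlow _ _ (by rw [hdd]; omega)
  have e1 := hone m (P (m + 1))
  have e2 := hone (m + 1) (P m)
  rw [hmon] at e1
  rw [hmd] at e2
  rw [hPP] at e1
  rcases Nat.even_or_odd m with hm | hm
  · have hf := hfac (m + 1) hm.add_one
    rw [hcoeff (m + 1) 0 (by simpa using hm.add_one)] at e1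
    have a1 : Φ (P (m + 1) * P m) = (P (m + 1)).divX.coeff 0 * Φ (X * P m) := by
      rw [← htwo m _ _ (by rw [hdd]; omega)]
      · congr 1
        linear_combination P m * hf
      · rw [coeff_divX]
        exact hcoeff _ _ (by grind)
    have a2 : Φ (X * (P (m + 1) * P (m + 1))) =
        (P (m + 1)).divX.coeff 0 * Φ (X ^ 2 * P (m + 1)) := by
      have := hone (m + 1) (P (m + 1)).divX
      rw [hlow (m + 1) _ (by rw [natDegree_divX_eq_natDegree_tsub_one, hdd]; omega),
        add_zero] at this
      rw [← this]
      congr 1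
      linear_combination X * P (m + 1) * hf
    have a3 : Φ (X * (P m * P m)) = (P m).coeff 0 * Φ (X * P m) :=
      htwo m _ (hcoeff _ _ (by grind)) (by rw [hdeg]; omega)
    rw [hm.neg_one_pow, a1, a2, a3]
    linear_combination (P (m + 1)).divX.coeff 0 * Φ (X * P m) * (e2 - e1)
  · have hf := hfac m hm
    rw [hcoeff m 0 (by simpa using hm)] at e2
    have a1 : Φ (P (m + 1) * P m) = (P m).divX.coeff 0 * Φ (X * P (m + 1)) := by
      rw [← htwo (m + 1) _ _ (by rw [hdd]; omega)]
      · congr 1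
        linear_combination P (m + 1) * hf
      · rw [coeff_divX]
        exact hcoeff _ _ (by grind)
    have a2 : Φ (X * (P m * P m)) = (P m).divX.coeff 0 * Φ (X ^ 2 * P m) := by
      have := hone m (P m).divX
      rw [hlow m _ (by rw [natDegree_divX_eq_natDegree_tsub_one, hdd]; grind), add_zero] at this
      rw [← this]
      congr 1
      linear_combination X * P m * hf
    have a3 : Φ (X * (P (m + 1) * P (m + 1))) =
        (P (m + 1)).coeff 0 * Φ (X * P (m + 1)) :=
      htwo (m + 1) _ (hcoeff _ _ (by grind)) (by rw [hdeg]; omega)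
    rw [hm.neg_one_pow, a1, a2, a3]
    linear_combination (P m).divX.coeff 0 * Φ (X * P (m + 1)) * (e2 - e1)

theorem difference_equation_of_moments {Φ : ℝ[X] →ₗ[ℝ] ℝ} {P : ℕ → ℝ[X]}
    (hmonic : ∀ n, (P n).Monic) (hdeg : ∀ n, (P n).natDegree = n)
    (horth : ∀ m n, m ≠ n → Φ (X ^ 3 * (P m * P n)) = 0)
    (hpos : ∀ n, 0 < Φ (X ^ 3 * (P n * P n)))
    (hneg : ∀ p : ℝ[X], Φ (p.comp (-X)) = -Φ p)
    (t : ℝ) (ht : t ≠ 0)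
    (hparts : ∀ p : ℝ[X],
      Φ (X ^ 3 * derivative p) = 2 * Φ (X ^ 4 * p) - 2 * t * Φ p)
    (hne : ∀ n, Φ (X * (P n * P n)) ≠ 0)
    (R : ℕ → ℝ)
    (hR : ∀ n, R n * Φ (X ^ 3 * (P n * P n)) = 2 * t * Φ (X * (P n * P n))) (m : ℕ) :
    4 * (-1 : ℝ) ^ (m + 1) * t * (((m + 1 : ℝ) + 1) * R (m + 2) - (m + 1 : ℝ) * R m)
        + (2 * (m + 1 : ℝ) + 1) * R (m + 2) * R (m + 1) * R m
      = (4 * (-1 : ℝ) ^ (m + 1) * t - R (m + 2) * R (m + 1))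
        * (4 * (-1 : ℝ) ^ (m + 1) * t + R (m + 1) * R m) := by
  have hL := moment_eq_coeff_mul hmonic hdeg horth
  have hc : ∀ n, (P n).coeff n = 1 := fun n => by
    simpa [hdeg] using (hmonic n).coeff_natDegree
  have hex : ∀ a : ℕ → ℝ, ∃ q : ℕ → ℝ, ∀ n, q n * Φ (X ^ 3 * (P n * P n)) = a n := fun a =>
    ⟨fun n => a n / Φ (X ^ 3 * (P n * P n)), fun n => div_mul_cancel₀ (a n) (hpos n).ne'⟩
  obtain ⟨r, hr⟩ := hex fun n => 2 * t * Φ (P (n + 1) * P n)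
  obtain ⟨β, hβ⟩ := hex fun n => Φ (X ^ 3 * (P (n + 1) * P (n + 1)))
  beta_reduce at hr hβ
  have hrβ : ∀ n, r n = 2 * β n - (n + 1) := fun n => by
    have h1 := hparts (P (n + 1) * P n)
    have h2 : X ^ 3 * derivative (P (n + 1) * P n) =
        X ^ 3 * (P n * derivative (P (n + 1))) + X ^ 3 * (P (n + 1) * derivative (P n)) := by
      rw [derivative_mul]; ring
    have h3 : X ^ 4 * (P (n + 1) * P n) = X ^ 3 * (P (n + 1) * (X * P n)) := by ring
    have d1 : (derivative (P (n + 1))).natDegree ≤ n :=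
      (natDegree_derivative_le _).trans (by rw [hdeg]; omega)
    have d2 : (derivative (P n)).natDegree < n + 1 :=
      (natDegree_derivative_le _).trans_lt (by rw [hdeg]; omega)
    have d3 : (X * P n).natDegree = n + 1 := by
      rw [natDegree_X_mul (hmonic n).ne_zero, hdeg]
    rw [h2, h3, map_add, hL n _ d1, hL (n + 1) _ d2.le, hL (n + 1) _ d3.le,
      coeff_eq_zero_of_natDegree_lt d2, coeff_derivative, coeff_X_mul, hc, hc] at h1
    apply mul_right_cancel₀ (hpos n).ne'
    linear_combination hr n - 2 * hβ n + h1
  have hRr : ∀ n, R (n + 1) = r (n + 1) + r n := fun n => by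
    have h1 := three_term_recurrence hmonic hdeg horth hpos hneg n
    rw [div_eq_of_eq_mul (hpos n).ne' (hβ n).symm] at h1
    have h2 : X * (P (n + 1) * P (n + 1)) =
        P (n + 2) * P (n + 1) + β n • (P (n + 1) * P n) := by
      rw [smul_eq_C_mul]
      linear_combination P (n + 1) * h1
    have h3 := congrArg Φ h2
    rw [map_add, map_smul, smul_eq_mul] at h3
    apply mul_right_cancel₀ (hpos (n + 1)).ne'
    have e1 := hR (n + 1)
    have e2 := hr (n + 1)
    linear_combination e1 - e2 + 2 * t * h3 - β n * hr n + r n * hβ n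
  have hA : ∀ n, 2 * t * (-1) ^ n * r n = β n * R (n + 1) * R n := fun n => by
    have h1 := ladder_compatibility hmonic hdeg horth hpos hneg n
    have hs : ((-1 : ℝ) ^ n) * (-1) ^ n = 1 := by
      rw [← pow_add, Even.neg_one_pow ⟨n, rfl⟩]
    apply mul_right_cancel₀ (mul_pos (hpos n) (hpos n)).ne'
    have h2 : β n * R (n + 1) * R n * (Φ (X ^ 3 * (P n * P n)) * Φ (X ^ 3 * (P n * P n))) =
        (2 * t * Φ (X * (P (n + 1) * P (n + 1)))) * (2 * t * Φ (X * (P n * P n))) := by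
      rw [← hR, ← hR, ← hβ]; ring
    rw [h2]
    linear_combination 2 * t * (-1) ^ n * Φ (X ^ 3 * (P n * P n)) * hr n
      + 4 * t ^ 2 * (-1) ^ n * h1
      + 4 * t ^ 2 * Φ (X * (P (n + 1) * P (n + 1))) * Φ (X * (P n * P n)) * hs
  have hR0 : R (m + 1) ≠ 0 := fun h0 => by
    have := hR (m + 1)
    rw [h0, zero_mul] at this
    exact hne (m + 1) (by simpa [ht] using this.symm)
  have g0 : r m * (4 * (-1) ^ (m + 1) * t + R (m + 1) * R m)
      = -(m + 1) * (R (m + 1) * R m) := by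
    rw [pow_succ]
    linear_combination (-2) * hA m + R (m + 1) * R m * hrβ m
  have g1 : r (m + 1) * (4 * (-1) ^ (m + 1) * t - R (m + 2) * R (m + 1))
      = (m + 1 + 1) * (R (m + 2) * R (m + 1)) := by
    have := hrβ (m + 1)
    push_cast at this
    linear_combination 2 * hA (m + 1) - R (m + 2) * R (m + 1) * this
  have c0 := hRr m
  generalize (-1 : ℝ) ^ (m + 1) = σ at *
  generalize R (m + 2) = R₂ at *
  apply mul_left_cancel₀ hR0
  linear_combination
    (-(4 * σ * t + R (m + 1) * R m)) * g1 - (4 * σ * t - R₂ * R (m + 1)) * g0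
    - (4 * σ * t - R₂ * R (m + 1)) * (4 * σ * t + R (m + 1) * R m) * c0

theorem w_nonneg (t x : ℝ) : 0 ≤ w t x := by
  unfold w; split_ifs <;> positivity

theorem w_neg (t x : ℝ) : w t (-x) = w t x := by simp [w]

theorem w_zero (t : ℝ) : w t 0 = 0 := by simp [w]

theorem measurable_w (t : ℝ) : Measurable (w t) := by
  unfold w
  exact Measurable.ite (measurableSet_singleton 0) measurable_const (by fun_prop)

theorem w_le {t : ℝ} (ht : 0 < t) (x : ℝ) :
    w t x ≤ 2 / t ^ 2 * x ^ 4 * Real.exp (-x ^ 2) := by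
  rcases eq_or_ne x 0 with rfl | hx
  · simp [w]
  have hu : 0 ≤ t / x ^ 2 := by positivity
  have h1 : (t / x ^ 2) ^ 2 / 2 ≤ Real.exp (t / x ^ 2) := by
    linarith [Real.quadratic_le_exp_of_nonneg hu]
  have h2 : Real.exp (-(t / x ^ 2)) ≤ 2 / t ^ 2 * x ^ 4 := by
    rw [Real.exp_neg]
    refine (inv_anti₀ (by positivity) h1).trans (le_of_eq ?_)
    field_simp
  rw [w, if_neg hx, sub_eq_add_neg, Real.exp_add, mul_comm]
  gcongr

theorem integrable_pow_div_mul_w {t : ℝ} (ht : 0 < t) (k : ℕ) :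
    Integrable fun x => x ^ k / x ^ 3 * w t x := by
  have h1 : Integrable fun x : ℝ => 2 / t ^ 2 * (x ^ (k + 1) * Real.exp (-1 * x ^ 2)) := by
    have := integrable_rpow_mul_exp_neg_mul_sq (b := 1) one_pos (s := (k + 1 : ℕ))
      (by have : (0 : ℝ) ≤ (k + 1 : ℕ) := by positivity
          linarith)
    simp only [Real.rpow_natCast] at this
    exact this.const_mul _
  refine h1.mono ((by fun_prop : Measurable fun x : ℝ => x ^ k / x ^ 3).mul
    (measurable_w t)).aestronglyMeasurable (ae_of_all _ fun x => ?_)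
  rcases eq_or_ne x 0 with rfl | hx
  · simp [w]
  have hx' : 0 < |x| := abs_pos.2 hx
  rw [norm_mul, Real.norm_of_nonneg (w_nonneg t x)]
  refine (mul_le_mul_of_nonneg_left (w_le ht x) (norm_nonneg _)).trans (le_of_eq ?_)
  have h4 : x ^ 4 = |x| ^ 4 := by rw [← abs_pow, abs_of_nonneg (by positivity)]
  simp only [norm_mul, norm_div, norm_pow, Real.norm_eq_abs, Real.abs_exp, h4]
  rw [abs_of_pos (by norm_num : (0 : ℝ) < 2), abs_of_pos ht]
  field_simp
  ring

theorem integrable_eval_div_mul_w {t : ℝ} (ht : 0 < t) (p : ℝ[X]) :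
    Integrable fun x => p.eval x / x ^ 3 * w t x := by
  induction p using Polynomial.induction_on' with
  | add p q hp hq =>
    refine (hp.add hq).congr (ae_of_all _ fun x => ?_)
    simp only [Pi.add_apply, eval_add]; ring
  | monomial k a =>
    refine ((integrable_pow_div_mul_w ht k).const_mul a).congr (ae_of_all _ fun x => ?_)
    simp only [eval_monomial]; ring

/-- The linear functional `p ↦ ∫ p(x) x⁻³ w(x,t) dx` on polynomials. -/
noncomputable def cubeMoment {t : ℝ} (ht : 0 < t) : ℝ[X] →ₗ[ℝ] ℝ where
  toFun p := ∫ x, p.eval x / x ^ 3 * w t x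
  map_add' p q := by
    rw [← integral_add (integrable_eval_div_mul_w ht p) (integrable_eval_div_mul_w ht q)]
    congr 1; ext x
    rw [eval_add]; ring
  map_smul' a p := by
    rw [RingHom.id_apply, smul_eq_mul, ← integral_const_mul]
    congr 1; ext x
    rw [eval_smul, smul_eq_mul]; ring

theorem cubeMoment_apply {t : ℝ} (ht : 0 < t) (p : ℝ[X]) :
    cubeMoment ht p = ∫ x, p.eval x / x ^ 3 * w t x := rfl

theorem eval_X_pow_mul_div_mul_w (t : ℝ) (p : ℝ[X]) (x : ℝ) :
    (X ^ 3 * p).eval x / x ^ 3 * w t x = p.eval x * w t x := by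
  rcases eq_or_ne x 0 with rfl | hx
  · simp [w]
  · rw [eval_mul, eval_pow, eval_X]
    field_simp

theorem cubeMoment_X_pow_mul {t : ℝ} (ht : 0 < t) (p : ℝ[X]) :
    cubeMoment ht (X ^ 3 * p) = ∫ x, p.eval x * w t x := by
  simp only [cubeMoment_apply, eval_X_pow_mul_div_mul_w]

theorem cubeMoment_X_mul {t : ℝ} (ht : 0 < t) (p : ℝ[X]) :
    cubeMoment ht (X * p) = ∫ x, p.eval x / x ^ 2 * w t x := by
  rw [cubeMoment_apply]
  congr 1; ext x
  rcases eq_or_ne x 0 with rfl | hx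
  · simp [w]
  · rw [eval_mul, eval_X]
    field_simp

theorem integrable_eval_mul_w {t : ℝ} (ht : 0 < t) (p : ℝ[X]) :
    Integrable fun x => p.eval x * w t x := by
  refine (integrable_eval_div_mul_w ht (X ^ 3 * p)).congr (ae_of_all _ fun x => ?_)
  exact eval_X_pow_mul_div_mul_w t p x

theorem cubeMoment_comp_neg_X {t : ℝ} (ht : 0 < t) (p : ℝ[X]) :
    cubeMoment ht (p.comp (-X)) = -cubeMoment ht p := by
  rw [cubeMoment_apply, cubeMoment_apply, ← integral_neg_eq_self, ← integral_neg]
  congr 1; ext x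
  rw [w_neg, eval_comp, eval_neg, eval_X, neg_neg, Odd.neg_pow (by decide), div_neg, neg_mul]

theorem hasDerivAt_w {t : ℝ} (ht : 0 < t) (x : ℝ) :
    HasDerivAt (w t) ((-2 * x + 2 * t / x ^ 3) * w t x) x := by
  rcases eq_or_ne x 0 with rfl | hx
  · rw [w_zero, mul_zero, hasDerivAt_iff_isLittleO]
    simp only [w_zero, sub_zero, smul_zero]
    refine Asymptotics.IsBigO.trans_isLittleO (g := fun x : ℝ => x ^ 4) ?_ ?_
    · refine Asymptotics.IsBigO.of_bound (2 / t ^ 2) (Filter.Eventually.of_forall fun x => ?_)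
      rw [Real.norm_of_nonneg (w_nonneg t x), Real.norm_of_nonneg (by positivity)]
      refine (w_le ht x).trans (mul_le_of_le_one_right (by positivity) ?_)
      exact Real.exp_le_one_iff.2 (by nlinarith [sq_nonneg x])
    · simpa using Asymptotics.isLittleO_pow_pow (𝕜 := ℝ) (m := 1) (n := 4) (by norm_num)
  · have h1 : HasDerivAt (fun y : ℝ => Real.exp (-y ^ 2 - t / y ^ 2))
        ((-2 * x + 2 * t / x ^ 3) * w t x) x := by
      have h2 : HasDerivAt (fun y : ℝ => -y ^ 2 - t / y ^ 2) (-2 * x + 2 * t / x ^ 3) x := by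
        have h3 := hasDerivAt_pow 2 x
        have h4 := h3.fun_neg.fun_sub ((hasDerivAt_const x t).fun_div h3 (pow_ne_zero 2 hx))
        refine h4.congr_deriv ?_
        norm_num
        field_simp
        ring
      refine h2.exp.congr_deriv ?_
      rw [w, if_neg hx, mul_comm]
    refine h1.congr_of_eventuallyEq ?_
    filter_upwards [isOpen_ne.mem_nhds hx] with y hy
    rw [w, if_neg hy]

theorem cubeMoment_X_pow_mul_derivative {t : ℝ} (ht : 0 < t) (p : ℝ[X]) :
    cubeMoment ht (X ^ 3 * derivative p) =
      2 * cubeMoment ht (X ^ 4 * p) - 2 * t * cubeMoment ht p := by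
  have hD : ∀ x, HasDerivAt (fun y => p.eval y * w t y)
      ((X ^ 3 * derivative p - (2 : ℝ) • (X ^ 4 * p) + (2 * t) • p).eval x / x ^ 3 * w t x) x := by
    intro x
    refine ((p.hasDerivAt x).fun_mul (hasDerivAt_w ht x)).congr_deriv ?_
    rcases eq_or_ne x 0 with rfl | hx
    · simp [w]
    · simp only [eval_add, eval_sub, eval_mul, eval_smul, eval_pow, eval_X, smul_eq_mul]
      field_simp
      ring
  have h0 := integral_eq_zero_of_hasDerivAt_of_integrable hD
    (integrable_eval_div_mul_w ht _) (integrable_eval_mul_w ht p)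
  rw [← cubeMoment_apply ht, map_add, map_sub, map_smul, map_smul, smul_eq_mul, smul_eq_mul] at h0
  linarith

theorem cubeMoment_X_mul_ne_zero {t : ℝ} (ht : 0 < t) (p : ℝ[X])
    (hp : cubeMoment ht (X ^ 3 * (p * p)) ≠ 0) : cubeMoment ht (X * (p * p)) ≠ 0 := by
  contrapose! hp
  have hi : Integrable fun x => (p * p).eval x / x ^ 2 * w t x := by
    refine (integrable_eval_div_mul_w ht (X * (p * p))).congr (ae_of_all _ fun x => ?_)
    rcases eq_or_ne x 0 with rfl | hx
    · simp [w]
    · simp only [eval_mul, eval_X]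
      field_simp
  rw [cubeMoment_X_mul, integral_eq_zero_iff_of_nonneg (fun x => ?_) hi] at hp
  · rw [cubeMoment_X_pow_mul]
    refine integral_eq_zero_of_ae ?_
    filter_upwards [hp] with x hx
    rcases eq_or_ne x 0 with rfl | hx0
    · simp [w]
    · simp only [Pi.zero_apply, mul_eq_zero, div_eq_zero_iff] at hx ⊢
      simpa [hx0] using hx
  · have := w_nonneg t x
    rw [eval_mul]
    exact mul_nonneg (div_nonneg (mul_self_nonneg _) (sq_nonneg _)) this

theorem statement9
    (t : ℝ) (ht : 0 < t)
    (P : ℕ → Polynomial ℝ)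
    (hmonic : ∀ n, (P n).Monic)
    (hdeg : ∀ n, (P n).natDegree = n)
    (horth : ∀ m n : ℕ, m ≠ n → ∫ x : ℝ, (P m).eval x * (P n).eval x * w t x = 0)
    (h : ℕ → ℝ)
    (hh : ∀ n, h n = ∫ x : ℝ, ((P n).eval x) ^ 2 * w t x)
    (hhpos : ∀ n, 0 < h n)
    (R : ℕ → ℝ)
    (hR : ∀ n, R n = 2 * t / h n * ∫ y : ℝ, ((P n).eval y) ^ 2 / y ^ 2 * w t y)
    (n : ℕ) (hn : 1 ≤ n) :
    4 * (-1 : ℝ) ^ n * t * (((n : ℝ) + 1) * R (n + 1) - (n : ℝ) * R (n - 1))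
        + (2 * (n : ℝ) + 1) * R (n + 1) * R n * R (n - 1)
      = (4 * (-1 : ℝ) ^ n * t - R (n + 1) * R n)
        * (4 * (-1 : ℝ) ^ n * t + R n * R (n - 1)) := by
  have hmom : ∀ m n, cubeMoment ht (X ^ 3 * (P m * P n)) =
      ∫ x : ℝ, (P m).eval x * (P n).eval x * w t x := fun m n => by
    simp only [cubeMoment_X_pow_mul, eval_mul]
  have hnorm : ∀ n, cubeMoment ht (X ^ 3 * (P n * P n)) = h n := fun n => by
    simp only [hmom, hh, sq]
  have hpos : ∀ n, 0 < cubeMoment ht (X ^ 3 * (P n * P n)) := fun n => by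
    rw [hnorm]; exact hhpos n
  have hR' : ∀ n, R n * cubeMoment ht (X ^ 3 * (P n * P n)) =
      2 * t * cubeMoment ht (X * (P n * P n)) := fun n => by
    have := (hhpos n).ne'
    rw [hnorm, hR, cubeMoment_X_mul]
    simp only [← sq, eval_pow]
    field_simp
  obtain ⟨m, rfl⟩ := Nat.exists_eq_add_of_le' hn
  have := difference_equation_of_moments hmonic hdeg
    (fun m n hmn => (hmom m n).trans (horth m n hmn)) hpos (cubeMoment_comp_neg_X ht) t ht.ne'
    (cubeMoment_X_pow_mul_derivative ht)
    (fun n => cubeMoment_X_mul_ne_zero ht _ (hpos n).ne') R hR' m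
  simpa using this
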